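/- Let n be a nonzero integer and ξ, η, ξ', η' ∈ C_c^∞(ℝ). Then ∫_ℝ ∫_ℝ ∫₀¹ ((2πi)⁻¹ (∂/∂θ)(ξ *ₙ η)(p,q,θ)) · (ξ' *₋ₙ η')(p,q,θ) dθ dq dp = sign(n) · (∫_ℝ ξ(x) ξ'(x) dx) · conj(∫_ℝ η(x) η'(x) dx), where sign(n) = n/|n|; the integrand on the left is integrable. -/

import Mathlib

open MeasureTheory Set

/-- Coefficient function of the `n`-th Schrödinger representation of the
reduced Heisenberg group:
`(ξ *ₙ η)(p,q,θ) = ∫_ℝ e^{2πi n q(−x + p/2)} e^{2πi n θ} ξ(−p + x) conj(η(x)) dx`. -/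
noncomputable def schCoeff (n : ℤ) (ξ η : ℝ → ℂ) (p q θ : ℝ) : ℂ :=
  ∫ x : ℝ,
    Complex.exp ((2 * Real.pi * (n : ℝ) * q * (-x + p / 2) : ℝ) * Complex.I)
      * Complex.exp ((2 * Real.pi * (n : ℝ) * θ : ℝ) * Complex.I)
      * ξ (-p + x) * starRingEnd ℂ (η x)

/-- `C_c^∞(ℝ)`: smooth, compactly supported, complex-valued functions on `ℝ`. -/
def CcInf (f : ℝ → ℂ) : Prop :=
  ContDiff ℝ (⊤ : ℕ∞) f ∧ HasCompactSupport f

/-- Haar measure `dp dq dθ` of the reduced Heisenberg group, modelled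
measure-theoretically on `ℝ × ℝ × [0,1)`. -/
noncomputable def muH : Measure (ℝ × ℝ × ℝ) :=
  (volume : Measure ℝ).prod
    ((volume : Measure ℝ).prod ((volume : Measure ℝ).restrict (Ico (0 : ℝ) 1)))

open scoped FourierTransform

lemma CcInf.conj {f : ℝ → ℂ} (hf : CcInf f) : CcInf (fun x => starRingEnd ℂ (f x)) :=
  ⟨Complex.conjCLE.contDiff.comp hf.1, hf.2.comp_left (map_zero _)⟩

lemma CcInf.mul {f g : ℝ → ℂ} (hf : CcInf f) (hg : CcInf g) : CcInf (fun x => f x * g x) :=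
  ⟨hf.1.mul hg.1, hf.2.mul_right⟩

lemma CcInf.integrable {f : ℝ → ℂ} (hf : CcInf f) : Integrable f :=
  hf.1.continuous.integrable_of_hasCompactSupport hf.2

/-- A function in `C_c^∞(ℝ)`, as a Schwartz function. -/
noncomputable def CcInf.toSchwartz {f : ℝ → ℂ} (hf : CcInf f) : SchwartzMap ℝ ℂ :=
  hf.2.toSchwartzMap hf.1

lemma CcInf.coe_toSchwartz {f : ℝ → ℂ} (hf : CcInf f) : ⇑hf.toSchwartz = f := rfl

/-- The function `x ↦ ξ(-p + x) conj(η(x))` whose Fourier transform gives `schCoeff`. -/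
noncomputable def schSlice (ξ η : ℝ → ℂ) (p x : ℝ) : ℂ :=
  ξ (-p + x) * starRingEnd ℂ (η x)

lemma CcInf.schSlice {ξ η : ℝ → ℂ} (hξ : CcInf ξ) (hη : CcInf η) (p : ℝ) :
    CcInf (schSlice ξ η p) :=
  ⟨(hξ.1.comp (contDiff_const.add contDiff_id)).mul hη.conj.1, hη.conj.2.mul_left⟩

lemma schCoeff_eq_fourier (n : ℤ) (ξ η : ℝ → ℂ) (p q θ : ℝ) :
    schCoeff n ξ η p q θ =
      Complex.exp ((2 * Real.pi * n * θ : ℝ) * Complex.I)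
        * (Complex.exp ((Real.pi * n * q * p : ℝ) * Complex.I) * 𝓕 (schSlice ξ η p) (n * q)) := by
  rw [Real.fourier_real_eq_integral_exp_smul, ← mul_assoc, ← integral_const_mul]
  refine integral_congr_ae (Filter.Eventually.of_forall fun x => ?_)
  simp only [schSlice, smul_eq_mul, ← mul_assoc, ← Complex.exp_add]
  congr 3
  push_cast
  ring

lemma deriv_schCoeff (n : ℤ) (ξ η : ℝ → ℂ) (p q θ : ℝ) :
    deriv (fun θ : ℝ => schCoeff n ξ η p q θ) θ =
      (2 * Real.pi * Complex.I) * n * schCoeff n ξ η p q θ := by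
  simp only [schCoeff_eq_fourier]
  have h : HasDerivAt (fun θ : ℝ => ((2 * Real.pi * n * θ : ℝ) : ℂ) * Complex.I)
      ((2 * Real.pi * n : ℝ) * Complex.I) θ := by
    simpa using (((hasDerivAt_id θ).const_mul (2 * Real.pi * (n : ℝ))).ofReal_comp).mul_const
      Complex.I
  rw [(h.cexp.mul_const _).deriv]
  push_cast
  ring

lemma schCoeff_mul_schCoeff_neg (n : ℤ) (ξ η ξ' η' : ℝ → ℂ) (p q θ : ℝ) :
    schCoeff n ξ η p q θ * schCoeff (-n) ξ' η' p q θ =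
      𝓕 (schSlice ξ η p) (n * q) * 𝓕 (schSlice ξ' η' p) (-n * q) := by
  rw [schCoeff_eq_fourier, schCoeff_eq_fourier]
  set a := 𝓕 (schSlice ξ η p) (n * q)
  have h : ((-n : ℤ) : ℝ) = -(n : ℝ) := by push_cast; rfl
  rw [h]
  set b := 𝓕 (schSlice ξ' η' p) (-n * q)
  have e (x y : ℂ) (hxy : x + y = 0) : Complex.exp x * Complex.exp y = 1 := by
    rw [← Complex.exp_add, hxy, Complex.exp_zero]
  have e₁ := e ((2 * Real.pi * n * θ : ℝ) * Complex.I) ((2 * Real.pi * -n * θ : ℝ) * Complex.I)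
    (by push_cast; ring)
  have e₂ := e ((Real.pi * n * q * p : ℝ) * Complex.I) ((Real.pi * -n * q * p : ℝ) * Complex.I)
    (by push_cast; ring)
  linear_combination a * b * e₁ + a * b * Complex.exp ((2 * Real.pi * n * θ : ℝ) * Complex.I)
    * Complex.exp ((2 * Real.pi * -n * θ : ℝ) * Complex.I) * e₂

lemma integrable_mul_comp_neg_add {a b : ℝ → ℂ} (ha : Integrable a) (hb : Integrable b) :
    Integrable (fun z : ℝ × ℝ => a (-z.1 + z.2) * b z.2) (volume.prod volume) := by
  have h := hb.convolution_integrand (ContinuousLinearMap.mul ℂ ℂ) ha.comp_neg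
  refine h.congr (Filter.Eventually.of_forall fun z => ?_)
  simp [mul_comm, sub_eq_neg_add]

lemma integral_integral_mul_comp_neg_add {a b : ℝ → ℂ} (ha : Integrable a) (hb : Integrable b) :
    ∫ p : ℝ, ∫ x : ℝ, a (-p + x) * b x = (∫ x, a x) * ∫ x, b x := by
  have h := integral_convolution (ContinuousLinearMap.mul ℂ ℂ) hb ha.comp_neg
  rw [integral_neg_eq_self] at h
  simpa [convolution, mul_comm, sub_eq_neg_add] using h

/-- Parseval's identity in bilinear form. -/
lemma CcInf.integral_fourier_mul_fourier_neg {f g : ℝ → ℂ} (hf : CcInf f) (hg : CcInf g) :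
    ∫ u, 𝓕 f u * 𝓕 g (-u) = ∫ x, f x * g x := by
  have h := SchwartzMap.integral_fourier_mul_eq hf.toSchwartz (𝓕⁻ hg.toSchwartz)
  rw [FourierTransform.fourier_fourierInv_eq] at h
  simpa only [SchwartzMap.fourier_coe, SchwartzMap.fourierInv_coe, CcInf.coe_toSchwartz,
    Real.fourierInv_eq_fourier_neg] using h

lemma CcInf.integral_norm_sq_fourier {f : ℝ → ℂ} (hf : CcInf f) :
    ∫ u, ‖𝓕 f u‖ ^ 2 = ∫ x, ‖f x‖ ^ 2 := by
  simpa only [SchwartzMap.fourier_coe, CcInf.coe_toSchwartz] using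
    SchwartzMap.integral_norm_sq_fourier hf.toSchwartz

lemma CcInf.integrable_norm_sq_fourier {f : ℝ → ℂ} (hf : CcInf f) :
    Integrable (fun u => ‖𝓕 f u‖ ^ 2) := by
  have h := (𝓕 hf.toSchwartz : SchwartzMap ℝ ℂ).memLp 2 volume
  rw [SchwartzMap.fourier_coe, hf.coe_toSchwartz] at h
  exact (memLp_two_iff_integrable_sq_norm h.1).1 h

lemma stronglyMeasurable_fourier_schSlice {ξ η : ℝ → ℂ} (hξ : CcInf ξ) (hη : CcInf η) (c : ℝ) :
    StronglyMeasurable (fun z : ℝ × ℝ => 𝓕 (schSlice ξ η z.1) (c * z.2)) := by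
  simp only [Real.fourier_real_eq_integral_exp_smul, schSlice]
  have h₁ := hξ.1.continuous
  have h₂ := hη.1.continuous
  refine StronglyMeasurable.integral_prod_right'
    (f := fun y : (ℝ × ℝ) × ℝ => Complex.exp ((-2 * Real.pi * y.2 * (c * y.1.2) : ℝ) * Complex.I)
      • (ξ (-y.1.1 + y.2) * starRingEnd ℂ (η y.2))) (Continuous.stronglyMeasurable ?_)
  fun_prop

lemma memLp_fourier_schSlice {ξ η : ℝ → ℂ} (hξ : CcInf ξ) (hη : CcInf η) {c : ℝ} (hc : c ≠ 0) :
    MemLp (fun z : ℝ × ℝ => 𝓕 (schSlice ξ η z.1) (c * z.2)) 2 (volume.prod volume) := by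
  have hm := (stronglyMeasurable_fourier_schSlice hξ hη c).aestronglyMeasurable
    (μ := (volume : Measure ℝ).prod volume)
  rw [memLp_two_iff_integrable_sq_norm hm]
  refine (integrable_prod_iff (hm.norm.pow 2)).2 ⟨Filter.Eventually.of_forall fun p =>
    (hξ.schSlice hη p).integrable_norm_sq_fourier.comp_mul_left' hc, ?_⟩
  have key (p : ℝ) : ∫ q, ‖‖𝓕 (schSlice ξ η p) (c * q)‖ ^ 2‖ =
      |c⁻¹| * ∫ x, ‖schSlice ξ η p x‖ ^ 2 := by
    simp only [norm_pow, norm_norm]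
    rw [Measure.integral_comp_mul_left (fun u => ‖𝓕 (schSlice ξ η p) u‖ ^ 2),
      (hξ.schSlice hη p).integral_norm_sq_fourier, smul_eq_mul]
  change Integrable fun p => ∫ q, ‖‖𝓕 (schSlice ξ η p) (c * q)‖ ^ 2‖
  simp only [key]
  have h := (integrable_mul_comp_neg_add (hξ.mul hξ.conj).integrable
    (hη.mul hη.conj).integrable).norm.integral_prod_left
  refine (h.congr (Filter.Eventually.of_forall fun p => ?_)).const_mul _
  refine integral_congr_ae (Filter.Eventually.of_forall fun x => ?_)
  simp only [schSlice, norm_mul, RCLike.norm_conj]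
  ring

lemma CcInf.integral_fourier_mul_fourier_neg_comp_mul {f g : ℝ → ℂ} (hf : CcInf f)
    (hg : CcInf g) (c : ℝ) :
    ∫ q, 𝓕 f (c * q) * 𝓕 g (-c * q) = |c⁻¹| * ∫ x, f x * g x := by
  simp only [neg_mul]
  rw [Measure.integral_comp_mul_left (fun u => 𝓕 f u * 𝓕 g (-u)),
    hf.integral_fourier_mul_fourier_neg hg, Complex.real_smul]

lemma integral_integral_schSlice_mul {ξ η ξ' η' : ℝ → ℂ} (hξ : CcInf ξ) (hη : CcInf η)
    (hξ' : CcInf ξ') (hη' : CcInf η') :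
    ∫ p, ∫ x, schSlice ξ η p x * schSlice ξ' η' p x =
      (∫ x, ξ x * ξ' x) * starRingEnd ℂ (∫ x, η x * η' x) := by
  rw [← integral_conj, ← integral_integral_mul_comp_neg_add (hξ.mul hξ').integrable
    (hη.mul hη').conj.integrable]
  simp only [schSlice, map_mul, mul_mul_mul_comm]

lemma intCast_mul_abs_inv (n : ℤ) (hn : n ≠ 0) :
    (n : ℂ) * ((|(n : ℝ)⁻¹| : ℝ) : ℂ) = (Int.sign n : ℤ) := by
  have hn' : (n : ℝ) ≠ 0 := Int.cast_ne_zero.2 hn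
  have h : (n : ℝ) * |(n : ℝ)⁻¹| = (Int.sign n : ℤ) := by
    rw [abs_inv, mul_inv_eq_iff_eq_mul₀ (abs_ne_zero.2 hn')]
    exact_mod_cast (Int.sign_mul_abs n).symm
  exact_mod_cast congrArg (fun r : ℝ => (r : ℂ)) h

lemma measurePreserving_muH :
    MeasurePreserving (fun x : ℝ × ℝ × ℝ => (x.1, x.2.1)) muH (volume.prod volume) := by
  have : IsProbabilityMeasure ((volume : Measure ℝ).restrict (Ico (0 : ℝ) 1)) :=
    ⟨by simp⟩
  exact (MeasurePreserving.id volume).prod measurePreserving_fst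

/-- Pairing `(2πi)⁻¹ ∂_θ (ξ *ₙ η)` against `ξ' *₋ₙ η'` in `L²(ℍ_r)` (the key
computation in the proof of Theorem 6.7 of Choi–Ghandehari): the value is
`sign(n) ⟨ξ, conj ξ'⟩ conj⟨η, conj η'⟩`, i.e.
`sign(n) (∫ ξ ξ') conj(∫ η η')`.  Here `∂_θ` is the derivative in `θ` of the function
extended to `θ ∈ ℝ` by the same formula. -/
theorem schCoeff_pairing_deriv (n : ℤ) (hn : n ≠ 0) (ξ η ξ' η' : ℝ → ℂ)
    (hξ : CcInf ξ) (hη : CcInf η) (hξ' : CcInf ξ') (hη' : CcInf η') :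
    Integrable (fun x : ℝ × ℝ × ℝ =>
      ((2 * (Real.pi : ℂ) * Complex.I)⁻¹
          * deriv (fun θ : ℝ => schCoeff n ξ η x.1 x.2.1 θ) x.2.2)
        * schCoeff (-n) ξ' η' x.1 x.2.1 x.2.2) muH ∧
    ∫ x, ((2 * (Real.pi : ℂ) * Complex.I)⁻¹
          * deriv (fun θ : ℝ => schCoeff n ξ η x.1 x.2.1 θ) x.2.2)
        * schCoeff (-n) ξ' η' x.1 x.2.1 x.2.2 ∂muH
      = ((Int.sign n : ℤ) : ℂ) * (∫ x : ℝ, ξ x * ξ' x)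
          * starRingEnd ℂ (∫ x : ℝ, η x * η' x) := by
  have hn' : (n : ℝ) ≠ 0 := Int.cast_ne_zero.2 hn
  set F : ℝ × ℝ → ℂ := fun z =>
    (n : ℂ) * (𝓕 (schSlice ξ η z.1) (n * z.2) * 𝓕 (schSlice ξ' η' z.1) (-n * z.2)) with hF
  have hFint : Integrable F (volume.prod volume) :=
    ((memLp_fourier_schSlice hξ hη hn').integrable_mul
      (memLp_fourier_schSlice hξ' hη' (neg_ne_zero.2 hn'))).const_mul _
  have hpull (x : ℝ × ℝ × ℝ) : ((2 * (Real.pi : ℂ) * Complex.I)⁻¹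
      * deriv (fun θ : ℝ => schCoeff n ξ η x.1 x.2.1 θ) x.2.2)
        * schCoeff (-n) ξ' η' x.1 x.2.1 x.2.2 = F (x.1, x.2.1) := by
    rw [deriv_schCoeff, mul_assoc _ (n : ℂ), inv_mul_cancel_left₀ Complex.two_pi_I_ne_zero,
      mul_assoc, schCoeff_mul_schCoeff_neg]
  simp only [hpull]
  refine ⟨measurePreserving_muH.integrable_comp_of_integrable hFint, ?_⟩
  have hmap := measurePreserving_muH.map_eq
  rw [← integral_map (f := F) measurePreserving_muH.measurable.aemeasurable
    (by rw [hmap]; exact hFint.1), hmap, integral_prod _ hFint]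
  simp only [hF, integral_const_mul]
  simp only [fun p => (hξ.schSlice hη p).integral_fourier_mul_fourier_neg_comp_mul
    (hξ'.schSlice hη' p) (n : ℝ), integral_const_mul]
  rw [integral_integral_schSlice_mul hξ hη hξ' hη', ← mul_assoc, intCast_mul_abs_inv n hn,
    mul_assoc]
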